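/- arXiv:2308.11238 — 2 statements merged into one kernel-verified Lean document; each statement's English description precedes it below -/
import Mathlib

section
/- Necessity in the S-shaped characterization: Let h be a strictly S-shaped distortion function with inflection point p∈(0,1). If a copula C is universally maximal for h with linear cost, then C = C^±_p and the right derivatives satisfy h'(p⁺) ≤ h'(0⁺). -/
open MeasureTheory Set ProbabilityTheory

noncomputable section

variable {Ω : Type*} [MeasurableSpace Ω]

/-- An atomless probability measure: every non-null measurable set has a measurable
subset of strictly smaller positive measure. -/
def AtomlessProb (P : Measure Ω) : Prop :=
  ∀ A : Set Ω, MeasurableSet A → 0 < P A →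
    ∃ B ⊆ A, MeasurableSet B ∧ 0 < P B ∧ P B < P A

/-- A distortion function: increasing on `[0,1]` with `h 0 = 0` and `h 1 = 1`. -/
def IsDistortion (h : ℝ → ℝ) : Prop :=
  MonotoneOn h (Icc 0 1) ∧ h 0 = 0 ∧ h 1 = 1

/-- The distorted expectation `E^h[Z]`. -/
def distExp (P : Measure Ω) (h : ℝ → ℝ) (Z : Ω → ℝ) : ℝ :=
  (∫ x in Ioi (0:ℝ), h (P {ω | Z ω > x}).toReal) +
  (∫ x in Iio (0:ℝ), (h (P {ω | Z ω > x}).toReal - 1))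

/-- Bounded measurable real random variable. -/
def IsBddRV (X : Ω → ℝ) : Prop :=
  Measurable X ∧ ∃ M : ℝ, ∀ ω, |X ω| ≤ M

/-- X and Y are comonotonic. -/
def Comonotone (P : Measure Ω) (X Y : Ω → ℝ) : Prop :=
  ∃ f g : ℝ → ℝ, Monotone f ∧ Monotone g ∧
    ∀ᵐ ω ∂P, X ω = f (X ω + Y ω) ∧ Y ω = g (X ω + Y ω)

/-- X and Y are counter-monotonic: X and -Y are comonotonic. -/
def CounterMonotone (P : Measure Ω) (X Y : Ω → ℝ) : Prop :=
  Comonotone P X (fun ω => -Y ω)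

def Submodular (c : ℝ → ℝ → ℝ) : Prop :=
  ∀ x₁ y₁ x₂ y₂ : ℝ,
    c (min x₁ x₂) (min y₁ y₂) + c (max x₁ x₂) (max y₁ y₂) ≤ c x₁ y₁ + c x₂ y₂

def Supermodular (c : ℝ → ℝ → ℝ) : Prop :=
  ∀ x₁ y₁ x₂ y₂ : ℝ,
    c x₁ y₁ + c x₂ y₂ ≤ c (min x₁ x₂) (min y₁ y₂) + c (max x₁ x₂) (max y₁ y₂)

/-- c is monotone: increasing in each argument or decreasing in each argument. -/
def MonotoneCost (c : ℝ → ℝ → ℝ) : Prop :=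
  Monotone (fun q : ℝ × ℝ => c q.1 q.2) ∨ Antitone (fun q : ℝ × ℝ => c q.1 q.2)

/-- A 2-copula. -/
def IsCopula (C : ℝ → ℝ → ℝ) : Prop :=
  (∀ u ∈ Icc (0:ℝ) 1, C u 0 = 0 ∧ C 0 u = 0 ∧ C u 1 = u ∧ C 1 u = u) ∧
  (∀ u₁ u₂ v₁ v₂ : ℝ, u₁ ∈ Icc (0:ℝ) 1 → u₂ ∈ Icc (0:ℝ) 1 →
    v₁ ∈ Icc (0:ℝ) 1 → v₂ ∈ Icc (0:ℝ) 1 → u₁ ≤ u₂ → v₁ ≤ v₂ →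
    0 ≤ C u₂ v₂ - C u₂ v₁ - C u₁ v₂ + C u₁ v₁)

/-- (X, Y) has copula C. -/
def HasCopula (P : Measure Ω) (X Y : Ω → ℝ) (C : ℝ → ℝ → ℝ) : Prop :=
  ∀ x y : ℝ, (P {ω | X ω ≤ x ∧ Y ω ≤ y}).toReal =
    C (P {ω | X ω ≤ x}).toReal (P {ω | Y ω ≤ y}).toReal

/-- C is universally optimal for h with linear cost. -/
def UnivOptimal (P : Measure Ω) (h : ℝ → ℝ) (C : ℝ → ℝ → ℝ) : Prop :=
  ∀ X Y X' Y' : Ω → ℝ, IsBddRV X → IsBddRV Y → IsBddRV X' → IsBddRV Y' →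
    HasCopula P X Y C → IdentDistrib X X' P P → IdentDistrib Y Y' P P →
    distExp P h (fun ω => X ω + Y ω) ≤ distExp P h (fun ω => X' ω + Y' ω)

/-- C is universally maximal for h with linear cost. -/
def UnivMaximal (P : Measure Ω) (h : ℝ → ℝ) (C : ℝ → ℝ → ℝ) : Prop :=
  ∀ X Y X' Y' : Ω → ℝ, IsBddRV X → IsBddRV Y → IsBddRV X' → IsBddRV Y' →
    HasCopula P X Y C → IdentDistrib X X' P P → IdentDistrib Y Y' P P →
    distExp P h (fun ω => X' ω + Y' ω) ≤ distExp P h (fun ω => X ω + Y ω)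

/-- C is universally optimal within a class 𝒞 of copulas for h with linear cost. -/
def UnivOptimalWithin (P : Measure Ω) (h : ℝ → ℝ) (C : ℝ → ℝ → ℝ)
    (𝒞 : Set (ℝ → ℝ → ℝ)) : Prop :=
  ∀ X Y X' Y' : Ω → ℝ, IsBddRV X → IsBddRV Y → IsBddRV X' → IsBddRV Y' →
    HasCopula P X Y C → (∃ C' ∈ 𝒞, HasCopula P X' Y' C') →
    IdentDistrib X X' P P → IdentDistrib Y Y' P P →
    distExp P h (fun ω => X ω + Y ω) ≤ distExp P h (fun ω => X' ω + Y' ω)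

/-- C is universally maximal within a class 𝒞 of copulas for h with linear cost. -/
def UnivMaximalWithin (P : Measure Ω) (h : ℝ → ℝ) (C : ℝ → ℝ → ℝ)
    (𝒞 : Set (ℝ → ℝ → ℝ)) : Prop :=
  ∀ X Y X' Y' : Ω → ℝ, IsBddRV X → IsBddRV Y → IsBddRV X' → IsBddRV Y' →
    HasCopula P X Y C → (∃ C' ∈ 𝒞, HasCopula P X' Y' C') →
    IdentDistrib X X' P P → IdentDistrib Y Y' P P →
    distExp P h (fun ω => X' ω + Y' ω) ≤ distExp P h (fun ω => X ω + Y ω)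

/-- The set 𝒞_p of copulas C with C(1-p,1-p) = 1-p. -/
def copulaSet (p : ℝ) : Set (ℝ → ℝ → ℝ) :=
  {C | IsCopula C ∧ C (1 - p) (1 - p) = 1 - p}

/-- The "first comonotonic, then counter-monotonic" copula C^±_p. -/
def Cpm (p : ℝ) (u v : ℝ) : ℝ :=
  if min u v ≤ 1 - p then min u v else max (u + v - 1) (1 - p)

/-- The "first counter-monotonic, then comonotonic" copula C^∓_p. -/
def Cmp (p : ℝ) (u v : ℝ) : ℝ :=
  if max u v ≤ 1 - p then max (u + v - 1 + p) 0 else min u v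

/-- Inverse S-shaped distortion with inflection point p: continuous, concave on (0,p),
convex on (p,1). -/
def IsISS (h : ℝ → ℝ) (p : ℝ) : Prop :=
  ContinuousOn h (Icc 0 1) ∧ ConcaveOn ℝ (Ioo 0 p) h ∧ ConvexOn ℝ (Ioo p 1) h

/-- Strictly inverse S-shaped distortion with inflection point p. -/
def IsStrictISS (h : ℝ → ℝ) (p : ℝ) : Prop :=
  ContinuousOn h (Icc 0 1) ∧ StrictConcaveOn ℝ (Ioo 0 p) h ∧ StrictConvexOn ℝ (Ioo p 1) h

/-- S-shaped distortion with inflection point p: continuous, convex on (0,p),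
concave on (p,1). -/
def IsSS (h : ℝ → ℝ) (p : ℝ) : Prop :=
  ContinuousOn h (Icc 0 1) ∧ ConvexOn ℝ (Ioo 0 p) h ∧ ConcaveOn ℝ (Ioo p 1) h

/-- Strictly S-shaped distortion with inflection point p. -/
def IsStrictSS (h : ℝ → ℝ) (p : ℝ) : Prop :=
  ContinuousOn h (Icc 0 1) ∧ StrictConvexOn ℝ (Ioo 0 p) h ∧ StrictConcaveOn ℝ (Ioo p 1) h

/-- Left quantile of Z at level t. -/
def leftQuantile (P : Measure Ω) (Z : Ω → ℝ) (t : ℝ) : ℝ :=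
  sInf {x : ℝ | t ≤ (P {ω | Z ω ≤ x}).toReal}

/-- W is (a version of) the upper p-tail transform Z^∨_p of Z: its left-quantile
function is t ↦ Q_{(1-p)+pt}(Z). -/
def IsUpperTail (P : Measure Ω) (p : ℝ) (Z W : Ω → ℝ) : Prop :=
  ∀ t ∈ Ioc (0:ℝ) 1, leftQuantile P W t = leftQuantile P Z ((1 - p) + p * t)

/-- W is (a version of) the lower tail transform Z^∧_p of Z: its left-quantile
function is t ↦ Q_{(1-p)t}(Z). -/
def IsLowerTail (P : Measure Ω) (p : ℝ) (Z W : Ω → ℝ) : Prop :=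
  ∀ t ∈ Ioc (0:ℝ) 1, leftQuantile P W t = leftQuantile P Z ((1 - p) * t)

/-- Expected Shortfall at level p. -/
def ES (P : Measure Ω) (p : ℝ) (Z : Ω → ℝ) : ℝ :=
  (1 / (1 - p)) * ∫ r in p..1, leftQuantile P Z r

/-! ### Subsets of prescribed measure -/

theorem AtomlessProb.exists_subset_pos_le {P : Measure Ω} [IsProbabilityMeasure P]
    (hP : AtomlessProb P) {A : Set Ω} (hA : MeasurableSet A) (hpos : 0 < P.real A)
    {ε : ℝ} (hε : 0 < ε) :
    ∃ B ⊆ A, MeasurableSet B ∧ 0 < P.real B ∧ P.real B ≤ ε := by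
  have half : ∀ A : Set Ω, MeasurableSet A → 0 < P.real A →
      ∃ B ⊆ A, MeasurableSet B ∧ 0 < P.real B ∧ P.real B ≤ P.real A / 2 := by
    intro A hA hpos
    obtain ⟨B, hBA, hB, hB0, hBlt⟩ := hP A hA (by
      rw [measureReal_def] at hpos
      exact (ENNReal.toReal_pos_iff.1 hpos).1)
    have h1 : 0 < P.real B := ENNReal.toReal_pos hB0.ne' (measure_ne_top _ _)
    have h2 : P.real B < P.real A :=
      (ENNReal.toReal_lt_toReal (measure_ne_top _ _) (measure_ne_top _ _)).2 hBlt
    have h3 : P.real (A \ B) = P.real A - P.real B := measureReal_sdiff hBA hB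
    by_cases hc : P.real B ≤ P.real A / 2
    · exact ⟨B, hBA, hB, h1, hc⟩
    · exact ⟨A \ B, sdiff_subset, hA.diff hB, by linarith, by linarith⟩
  have iter : ∀ n : ℕ, ∃ B ⊆ A, MeasurableSet B ∧ 0 < P.real B ∧
      P.real B ≤ P.real A * (1 / 2) ^ n := by
    intro n
    induction n with
    | zero => exact ⟨A, Subset.rfl, hA, hpos, by simp⟩
    | succ n ih =>
      obtain ⟨B, hBA, hB, hB0, hBle⟩ := ih
      obtain ⟨B', hB'B, hB', hB'0, hB'le⟩ := half B hB hB0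
      exact ⟨B', hB'B.trans hBA, hB', hB'0, by rw [pow_succ]; linarith⟩
  obtain ⟨n, hn⟩ := exists_pow_lt_of_lt_one (div_pos hε hpos) (by norm_num : (1 / 2 : ℝ) < 1)
  obtain ⟨B, hBA, hB, hB0, hBle⟩ := iter n
  refine ⟨B, hBA, hB, hB0, hBle.trans ?_⟩
  rw [lt_div_iff₀ hpos] at hn
  linarith

/-- Sierpiński's theorem: an atomless probability measure takes every intermediate value on the
measurable subsets of a measurable set. -/
theorem AtomlessProb.exists_subset_measureReal_eq {P : Measure Ω} [IsProbabilityMeasure P]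
    (hP : AtomlessProb P) {A : Set Ω} (hA : MeasurableSet A) {t : ℝ} (ht0 : 0 ≤ t)
    (ht : t ≤ P.real A) :
    ∃ B ⊆ A, MeasurableSet B ∧ P.real B = t := by
  have step : ∀ B : {B : Set Ω // MeasurableSet B ∧ B ⊆ A ∧ P.real B ≤ t},
      ∃ B' : {B : Set Ω // MeasurableSet B ∧ B ⊆ A ∧ P.real B ≤ t}, B.1 ⊆ B'.1 ∧
        ∀ D ⊆ A \ B.1, MeasurableSet D → P.real B.1 + P.real D ≤ t →
          P.real D ≤ 2 * (P.real B'.1 - P.real B.1) := by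
    rintro ⟨B, hB, hBA, hBt⟩
    set S : Set ℝ := {r | ∃ D ⊆ A \ B, MeasurableSet D ∧ P.real D = r ∧ P.real B + r ≤ t}
      with hS
    have hbdd : BddAbove S := ⟨t - P.real B, by rintro r ⟨D, -, -, -, h⟩; linarith⟩
    have h0 : (0 : ℝ) ∈ S := ⟨∅, empty_subset _, .empty, by simp, by simpa using hBt⟩
    obtain hs | hs := (le_csSup hbdd h0).eq_or_lt
    · refine ⟨⟨B, hB, hBA, hBt⟩, Subset.rfl, fun D hD hDm hDt => ?_⟩
      have : P.real D ≤ sSup S := le_csSup hbdd ⟨D, hD, hDm, rfl, hDt⟩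
      simp only [sub_self, mul_zero]
      linarith
    · obtain ⟨r, ⟨D, hD, hDm, hDr, hDt⟩, hr⟩ := exists_lt_of_lt_csSup ⟨0, h0⟩ (half_lt_self hs)
      have hdisj : Disjoint B D := disjoint_sdiff_right.mono_right hD
      have hun : P.real (B ∪ D) = P.real B + r := by
        rw [measureReal_union hdisj hDm, hDr]
      refine ⟨⟨B ∪ D, hB.union hDm, union_subset hBA (hD.trans sdiff_subset), by linarith⟩,
        subset_union_left, fun D' hD' hDm' hDt' => ?_⟩
      have : P.real D' ≤ sSup S := le_csSup hbdd ⟨D', hD', hDm', rfl, hDt'⟩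
      simp only [hun]
      linarith
  choose next hsub hnext using step
  let b : ℕ → {B : Set Ω // MeasurableSet B ∧ B ⊆ A ∧ P.real B ≤ t} := fun n =>
    Nat.rec ⟨∅, .empty, empty_subset _, by simpa using ht0⟩ (fun _ B => next B) n
  have hb : ∀ n, b (n + 1) = next (b n) := fun n => rfl
  have hmono : Monotone fun n => (b n).1 :=
    monotone_nat_of_le_succ fun n => by rw [hb]; exact hsub _
  set U : Set Ω := ⋃ n, (b n).1 with hU
  have hUm : MeasurableSet U := .iUnion fun n => (b n).2.1
  have hUA : U ⊆ A := iUnion_subset fun n => (b n).2.2.1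
  have hlim : Filter.Tendsto (fun n => P.real (b n).1) Filter.atTop (nhds (P.real U)) :=
    (ENNReal.tendsto_toReal (measure_ne_top _ _)).comp (tendsto_measure_iUnion_atTop hmono)
  have hUt : P.real U ≤ t := le_of_tendsto' hlim fun n => (b n).2.2.2
  refine ⟨U, hUA, hUm, hUt.antisymm ?_⟩
  by_contra! hlt
  have hdiff : P.real (A \ U) = P.real A - P.real U := measureReal_sdiff hUA hUm
  obtain ⟨D, hD, hDm, hD0, hDle⟩ := hP.exists_subset_pos_le (hA.diff hUm)
    (by linarith : 0 < P.real (A \ U)) (sub_pos.2 hlt)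
  have hgrow : ∀ n : ℕ, n * (P.real D / 2) ≤ P.real (b n).1 := by
    intro n
    induction n with
    | zero => simp
    | succ n ih =>
      have hle : P.real (b n).1 ≤ P.real U := measureReal_mono (subset_iUnion (fun n => (b n).1) n)
      have := hnext (b n) D
        (hD.trans (sdiff_subset_sdiff_right (subset_iUnion (fun n => (b n).1) n))) hDm (by linarith)
      rw [hb]
      push_cast
      linarith
  obtain ⟨n, hn⟩ := exists_nat_gt (t / (P.real D / 2))
  rw [div_lt_iff₀ (by linarith)] at hn
  have := hgrow n
  have := (b n).2.2.2
  linarith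

/-- A measurable set meeting the three layers of a chain `A₂ ⊆ A₁` in prescribed measures. -/
theorem AtomlessProb.exists_set_meeting_chain {P : Measure Ω} [IsProbabilityMeasure P]
    (hP : AtomlessProb P) {A₁ A₂ : Set Ω} (hA₁ : MeasurableSet A₁) (hA₂ : MeasurableSet A₂)
    (hA : A₂ ⊆ A₁) {b₁ b₂ b₃ : ℝ} (h₁ : 0 ≤ b₁) (h₁' : b₁ ≤ P.real A₂)
    (h₂ : 0 ≤ b₂) (h₂' : b₂ ≤ P.real A₁ - P.real A₂)
    (h₃ : 0 ≤ b₃) (h₃' : b₃ ≤ 1 - P.real A₁) :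
    ∃ B, MeasurableSet B ∧ P.real B = b₁ + b₂ + b₃ ∧ P.real (A₁ ∪ B) = P.real A₁ + b₃ ∧
      P.real (A₂ ∪ B) = P.real A₂ + b₂ + b₃ ∧ P.real (A₂ ∪ A₁ ∩ B) = P.real A₂ + b₂ ∧
      P.real (A₂ ∩ B) = b₁ := by
  obtain ⟨B₁, hB₁, hm₁, rfl⟩ := hP.exists_subset_measureReal_eq hA₂ h₁ h₁'
  obtain ⟨B₂, hB₂, hm₂, rfl⟩ := hP.exists_subset_measureReal_eq (hA₁.diff hA₂) h₂
    (by rwa [measureReal_sdiff hA hA₂])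
  obtain ⟨B₃, hB₃, hm₃, rfl⟩ := hP.exists_subset_measureReal_eq hA₁.compl h₃
    (by rwa [probReal_compl_eq_one_sub hA₁])
  have n₁ : ∀ x ∈ B₁, x ∈ A₂ := fun x hx => hB₁ hx
  have n₂ : ∀ x ∈ B₂, x ∈ A₁ ∧ x ∉ A₂ := fun x hx => hB₂ hx
  have n₃ : ∀ x ∈ B₃, x ∉ A₁ := fun x hx => hB₃ hx
  have n : ∀ x ∈ A₂, x ∈ A₁ := fun x hx => hA hx
  have d₁₂ : Disjoint B₁ B₂ := disjoint_left.2 fun x hx hx' => (n₂ x hx').2 (n₁ x hx)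
  have d₃ : Disjoint (B₁ ∪ B₂) B₃ := disjoint_left.2 fun x hx hx' => by
    have := n₁ x; have := n₂ x; have := n₃ x; have := n x
    simp only [mem_union] at hx
    tauto
  have e₁ : A₁ ∪ (B₁ ∪ B₂ ∪ B₃) = A₁ ∪ B₃ := by
    ext x
    have := n₁ x; have := n₂ x; have := n₃ x; have := n x
    simp only [mem_union]
    tauto
  have e₂ : A₂ ∪ (B₁ ∪ B₂ ∪ B₃) = A₂ ∪ B₂ ∪ B₃ := by
    ext x
    have := n₁ x; have := n₂ x; have := n₃ x; have := n x
    simp only [mem_union]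
    tauto
  have e₃ : A₂ ∪ A₁ ∩ (B₁ ∪ B₂ ∪ B₃) = A₂ ∪ B₂ := by
    ext x
    have := n₁ x; have := n₂ x; have := n₃ x; have := n x
    simp only [mem_union, mem_inter_iff]
    tauto
  have e₄ : A₂ ∩ (B₁ ∪ B₂ ∪ B₃) = B₁ := by
    ext x
    have := n₁ x; have := n₂ x; have := n₃ x; have := n x
    simp only [mem_union, mem_inter_iff]
    tauto
  have d₂ : Disjoint A₂ B₂ := disjoint_left.2 fun x hx hx' => (n₂ x hx').2 hx
  refine ⟨B₁ ∪ B₂ ∪ B₃, (hm₁.union hm₂).union hm₃, ?_, ?_, ?_, ?_, by rw [e₄]⟩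
  · rw [measureReal_union d₃ hm₃, measureReal_union d₁₂ hm₂]
  · rw [e₁, measureReal_union (disjoint_left.2 fun x hx hx' => n₃ x hx' hx) hm₃]
  · rw [e₂, measureReal_union (disjoint_left.2 fun x hx hx' => n₃ x hx' ?_) hm₃,
      measureReal_union d₂ hm₂]
    exact hx.elim (n x) fun h => (n₂ x h).1
  · rw [e₃, measureReal_union d₂ hm₂]

/-! ### Sums of indicators -/

theorem identDistrib_indicator_one {P : Measure Ω} [IsProbabilityMeasure P] {A B : Set Ω}
    (hA : MeasurableSet A) (hB : MeasurableSet B) (h : P.real A = P.real B) :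
    IdentDistrib (A.indicator (fun _ => (1 : ℝ))) (B.indicator fun _ => (1 : ℝ)) P P where
  aemeasurable_fst := (measurable_const.indicator hA).aemeasurable
  aemeasurable_snd := (measurable_const.indicator hB).aemeasurable
  map_eq := by
    have hAB : P A = P B := by
      rwa [measureReal_def, measureReal_def,
        ENNReal.toReal_eq_toReal_iff' (measure_ne_top _ _) (measure_ne_top _ _)] at h
    ext s hs
    rw [Measure.map_apply (measurable_const.indicator hA) hs,
      Measure.map_apply (measurable_const.indicator hB) hs]
    classical
    rw [indicator_const_preimage_eq_union, indicator_const_preimage_eq_union]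
    split_ifs <;> simp [hAB, prob_compl_eq_one_sub, hA, hB]

theorem isBddRV_indicator_one {A : Set Ω} (hA : MeasurableSet A) :
    IsBddRV (A.indicator fun _ => (1 : ℝ)) := by
  refine ⟨measurable_const.indicator hA, 1, fun ω => ?_⟩
  by_cases h : ω ∈ A <;> simp [h]

theorem IsBddRV.add {X Y : Ω → ℝ} (hX : IsBddRV X) (hY : IsBddRV Y) :
    IsBddRV fun ω => X ω + Y ω := by
  obtain ⟨hX, M, hM⟩ := hX
  obtain ⟨hY, N, hN⟩ := hY
  exact ⟨hX.add hY, M + N, fun ω => (abs_add_le _ _).trans (add_le_add (hM ω) (hN ω))⟩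

theorem distExp_indicator_chain_add {P : Measure Ω} [IsProbabilityMeasure P] {h : ℝ → ℝ}
    (h0 : h 0 = 0) (h1 : h 1 = 1) {A₁ A₂ B : Set Ω} (hA : A₂ ⊆ A₁) :
    distExp P h (fun ω => (A₁.indicator (fun _ => (1 : ℝ)) ω + A₂.indicator (fun _ => (1 : ℝ)) ω)
        + B.indicator (fun _ => (1 : ℝ)) ω) =
      h (P.real (A₁ ∪ B)) + h (P.real (A₂ ∪ A₁ ∩ B)) + h (P.real (A₂ ∩ B)) := by
  set Z : Ω → ℝ := fun ω => (A₁.indicator (fun _ => (1 : ℝ)) ω +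
    A₂.indicator (fun _ => (1 : ℝ)) ω) + B.indicator (fun _ => (1 : ℝ)) ω with hZ
  have neg : ∀ x < (0 : ℝ), {ω | Z ω > x} = univ := by
    intro x hx
    ext ω
    have := @hA ω
    by_cases a₁ : ω ∈ A₁ <;> by_cases a₂ : ω ∈ A₂ <;> by_cases b : ω ∈ B <;>
      simp [hZ, a₁, a₂, b] at this ⊢ <;> linarith
  have s₁ : ∀ x : ℝ, 0 ≤ x → x < 1 → {ω | Z ω > x} = A₁ ∪ B := by
    intro x hx hx'
    ext ω
    have := @hA ω
    by_cases a₁ : ω ∈ A₁ <;> by_cases a₂ : ω ∈ A₂ <;> by_cases b : ω ∈ B <;>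
      simp [hZ, a₁, a₂, b] at this ⊢ <;> linarith
  have s₂ : ∀ x : ℝ, 1 ≤ x → x < 2 → {ω | Z ω > x} = A₂ ∪ A₁ ∩ B := by
    intro x hx hx'
    ext ω
    have := @hA ω
    by_cases a₁ : ω ∈ A₁ <;> by_cases a₂ : ω ∈ A₂ <;> by_cases b : ω ∈ B <;>
      simp [hZ, a₁, a₂, b] at this ⊢ <;> linarith
  have s₃ : ∀ x : ℝ, 2 ≤ x → x < 3 → {ω | Z ω > x} = A₂ ∩ B := by
    intro x hx hx'
    ext ω
    have := @hA ω
    by_cases a₁ : ω ∈ A₁ <;> by_cases a₂ : ω ∈ A₂ <;> by_cases b : ω ∈ B <;>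
      simp [hZ, a₁, a₂, b] at this ⊢ <;> linarith
  have s₄ : ∀ x : ℝ, 3 ≤ x → {ω | Z ω > x} = ∅ := by
    intro x hx
    ext ω
    have := @hA ω
    by_cases a₁ : ω ∈ A₁ <;> by_cases a₂ : ω ∈ A₂ <;> by_cases b : ω ∈ B <;>
      simp [hZ, a₁, a₂, b] at this ⊢ <;> linarith
  have hneg : ∫ x in Iio (0 : ℝ), (h (P {ω | Z ω > x}).toReal - 1) = 0 := by
    rw [setIntegral_congr_fun measurableSet_Iio (g := fun _ => (0 : ℝ)) fun x hx => ?_]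
    · simp
    · simp [neg x hx, h1]
  have hpos : ∀ x ∈ Ioi (0 : ℝ), h (P {ω | Z ω > x}).toReal =
      ((Ioo (0 : ℝ) 1).indicator (fun _ => h (P.real (A₁ ∪ B))) x +
        (Ico (1 : ℝ) 2).indicator (fun _ => h (P.real (A₂ ∪ A₁ ∩ B))) x) +
        (Ico (2 : ℝ) 3).indicator (fun _ => h (P.real (A₂ ∩ B))) x := by
    intro x hx
    have hx : 0 < x := hx
    simp only [indicator_apply, mem_Ioo, mem_Ico]
    rcases lt_or_ge x 1 with c₁ | c₁
    · rw [s₁ x hx.le c₁, if_pos ⟨hx, c₁⟩, if_neg (fun c => by linarith [c.1]),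
        if_neg (fun c => by linarith [c.1])]
      simp [measureReal_def]
    rcases lt_or_ge x 2 with c₂ | c₂
    · rw [s₂ x c₁ c₂, if_neg (fun c => by linarith [c.2]), if_pos ⟨c₁, c₂⟩,
        if_neg (fun c => by linarith [c.1])]
      simp [measureReal_def]
    rcases lt_or_ge x 3 with c₃ | c₃
    · rw [s₃ x c₂ c₃, if_neg (fun c => by linarith [c.2]), if_neg (fun c => by linarith [c.2]),
        if_pos ⟨c₂, c₃⟩]
      simp [measureReal_def]
    · rw [s₄ x c₃, if_neg (fun c => by linarith [c.2]), if_neg (fun c => by linarith [c.2]),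
        if_neg (fun c => by linarith [c.2])]
      simp [h0]
  have i₁ : ∀ c : ℝ, Integrable ((Ioo (0 : ℝ) 1).indicator fun _ => c)
      (volume.restrict (Ioi 0)) := fun c =>
    ((integrable_indicator_iff measurableSet_Ioo).2 (by simp)).integrableOn
  have i₂ : ∀ a b c : ℝ, Integrable ((Ico a b).indicator fun _ => c)
      (volume.restrict (Ioi 0)) := fun a b c =>
    ((integrable_indicator_iff measurableSet_Ico).2 (by simp)).integrableOn
  have i₃ : Integrable (fun x => (Ioo (0 : ℝ) 1).indicator (fun _ => h (P.real (A₁ ∪ B))) x +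
      (Ico (1 : ℝ) 2).indicator (fun _ => h (P.real (A₂ ∪ A₁ ∩ B))) x)
      (volume.restrict (Ioi 0)) := (i₁ _).add (i₂ _ _ _)
  have v₁ : Ioi (0 : ℝ) ∩ Ioo 0 1 = Ioo 0 1 :=
    inter_eq_right.2 fun x hx => hx.1
  have v₂ : Ioi (0 : ℝ) ∩ Ico 1 2 = Ico 1 2 :=
    inter_eq_right.2 fun x hx => lt_of_lt_of_le one_pos hx.1
  have v₃ : Ioi (0 : ℝ) ∩ Ico 2 3 = Ico 2 3 :=
    inter_eq_right.2 fun x hx => lt_of_lt_of_le two_pos hx.1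
  rw [distExp, hneg, setIntegral_congr_fun measurableSet_Ioi hpos,
    integral_add i₃ (i₂ _ _ _), integral_add (i₁ _) (i₂ _ _ _),
    setIntegral_indicator measurableSet_Ioo, setIntegral_indicator measurableSet_Ico,
    setIntegral_indicator measurableSet_Ico, v₁, v₂, v₃]
  simp
  norm_num

/-! ### Copulas -/

theorem IsCopula.swap {C : ℝ → ℝ → ℝ} (hC : IsCopula C) : IsCopula fun u v => C v u := by
  refine ⟨fun u hu => ?_, fun u₁ u₂ v₁ v₂ hu₁ hu₂ hv₁ hv₂ hu hv => ?_⟩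
  · obtain ⟨h₁, h₂, h₃, h₄⟩ := hC.1 u hu
    exact ⟨h₂, h₁, h₄, h₃⟩
  · have := hC.2 v₁ v₂ u₁ u₂ hv₁ hv₂ hu₁ hu₂ hv hu
    linarith

theorem UnivMaximal.swap {P : Measure Ω} {h : ℝ → ℝ} {C : ℝ → ℝ → ℝ}
    (hmax : UnivMaximal P h C) : UnivMaximal P h fun u v => C v u := by
  intro X Y X' Y' hX hY hX' hY' hcop hXX' hYY'
  have := hmax Y X Y' X' hY hX hY' hX' (fun x y => by
    have := hcop y x
    simp only [and_comm] at this ⊢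
    exact this) hYY' hXX'
  simpa only [add_comm] using this

/-- The dual of a copula: the probability of `A ∪ B` for upper-level sets `A` and `B` of
probabilities `a` and `b` coupled by the copula `C`. -/
def copulaDual (C : ℝ → ℝ → ℝ) (a b : ℝ) : ℝ := 1 - C (1 - a) (1 - b)

namespace IsCopula

variable {C : ℝ → ℝ → ℝ} {a a' b : ℝ}

theorem copulaDual_zero_right (hC : IsCopula C) (ha : a ∈ Icc (0 : ℝ) 1) :
    copulaDual C a 0 = a := by
  have := (hC.1 (1 - a) ⟨by linarith [ha.2], by linarith [ha.1]⟩).2.2.1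
  simp [copulaDual, this]

theorem copulaDual_zero_left (hC : IsCopula C) (ha : a ∈ Icc (0 : ℝ) 1) :
    copulaDual C 0 a = a := by
  have := (hC.1 (1 - a) ⟨by linarith [ha.2], by linarith [ha.1]⟩).2.2.2
  simp [copulaDual, this]

theorem copulaDual_mono_left (hC : IsCopula C) (ha : a ∈ Icc (0 : ℝ) 1)
    (ha' : a' ∈ Icc (0 : ℝ) 1) (hb : b ∈ Icc (0 : ℝ) 1) (h : a ≤ a') :
    copulaDual C a b ≤ copulaDual C a' b := by
  obtain ⟨ha0, ha1⟩ := ha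
  obtain ⟨ha0', ha1'⟩ := ha'
  obtain ⟨hb0, hb1⟩ := hb
  have h₁ := hC.2 (1 - a') (1 - a) 0 (1 - b) ⟨by linarith, by linarith⟩
    ⟨by linarith, by linarith⟩ ⟨by linarith, by linarith⟩ ⟨by linarith, by linarith⟩
    (by linarith) (by linarith)
  have h₂ := (hC.1 (1 - a) ⟨by linarith, by linarith⟩).1
  have h₃ := (hC.1 (1 - a') ⟨by linarith, by linarith⟩).1
  simp only [copulaDual]
  linarith

theorem copulaDual_sub_le (hC : IsCopula C) (ha : a ∈ Icc (0 : ℝ) 1)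
    (ha' : a' ∈ Icc (0 : ℝ) 1) (hb : b ∈ Icc (0 : ℝ) 1) (h : a ≤ a') :
    copulaDual C a' b - copulaDual C a b ≤ a' - a := by
  obtain ⟨ha0, ha1⟩ := ha
  obtain ⟨ha0', ha1'⟩ := ha'
  obtain ⟨hb0, hb1⟩ := hb
  have h₁ := hC.2 (1 - a') (1 - a) (1 - b) 1 ⟨by linarith, by linarith⟩
    ⟨by linarith, by linarith⟩ ⟨by linarith, by linarith⟩ ⟨by linarith, by linarith⟩
    (by linarith) (by linarith)
  have h₂ := (hC.1 (1 - a) ⟨by linarith, by linarith⟩).2.2.1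
  have h₃ := (hC.1 (1 - a') ⟨by linarith, by linarith⟩).2.2.1
  simp only [copulaDual]
  linarith

theorem copulaDual_mono_right (hC : IsCopula C) (ha : a ∈ Icc (0 : ℝ) 1)
    (ha' : a' ∈ Icc (0 : ℝ) 1) (hb : b ∈ Icc (0 : ℝ) 1) (h : a ≤ a') :
    copulaDual C b a ≤ copulaDual C b a' :=
  hC.swap.copulaDual_mono_left ha ha' hb h

theorem le_copulaDual_left (hC : IsCopula C) (ha : a ∈ Icc (0 : ℝ) 1)
    (hb : b ∈ Icc (0 : ℝ) 1) : a ≤ copulaDual C a b := by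
  have := hC.copulaDual_mono_right ⟨le_rfl, zero_le_one⟩ hb ha hb.1
  rwa [hC.copulaDual_zero_right ha] at this

theorem le_copulaDual_right (hC : IsCopula C) (ha : a ∈ Icc (0 : ℝ) 1)
    (hb : b ∈ Icc (0 : ℝ) 1) : b ≤ copulaDual C a b :=
  hC.swap.le_copulaDual_left hb ha

theorem copulaDual_le_add (hC : IsCopula C) (ha : a ∈ Icc (0 : ℝ) 1)
    (hb : b ∈ Icc (0 : ℝ) 1) : copulaDual C a b ≤ a + b := by
  have := hC.copulaDual_sub_le ⟨le_rfl, zero_le_one⟩ ha hb ha.1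
  rw [hC.copulaDual_zero_left hb] at this
  linarith

theorem copulaDual_le_one (hC : IsCopula C) (ha : a ∈ Icc (0 : ℝ) 1)
    (hb : b ∈ Icc (0 : ℝ) 1) : copulaDual C a b ≤ 1 := by
  have := hC.copulaDual_mono_left ha ⟨zero_le_one, le_rfl⟩ hb ha.2
  have h := (hC.1 (1 - b) ⟨by linarith [hb.2], by linarith [hb.1]⟩).2.1
  simp only [copulaDual, sub_self, h] at this ⊢
  linarith

theorem continuousOn_copulaDual_left (hC : IsCopula C) (hb : b ∈ Icc (0 : ℝ) 1) :
    ContinuousOn (fun a => copulaDual C a b) (Icc 0 1) := by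
  refine LipschitzOnWith.continuousOn (K := 1) (LipschitzOnWith.of_dist_le_mul ?_)
  intro x hx y hy
  rw [NNReal.coe_one, one_mul, Real.dist_eq, Real.dist_eq]
  rcases le_total x y with h | h
  · rw [abs_sub_comm, abs_sub_comm x, abs_of_nonneg (sub_nonneg.2 h),
      abs_of_nonneg (sub_nonneg.2 (hC.copulaDual_mono_left hx hy hb h))]
    exact hC.copulaDual_sub_le hx hy hb h
  · rw [abs_of_nonneg (sub_nonneg.2 h),
      abs_of_nonneg (sub_nonneg.2 (hC.copulaDual_mono_left hy hx hb h))]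
    exact hC.copulaDual_sub_le hy hx hb h

theorem continuousOn_copulaDual_right (hC : IsCopula C) (hb : b ∈ Icc (0 : ℝ) 1) :
    ContinuousOn (fun a => copulaDual C b a) (Icc 0 1) :=
  hC.swap.continuousOn_copulaDual_left hb

end IsCopula

/-- Indicator sums over a chain have copula `C` as soon as the unions have the measures
prescribed by the dual of `C`. -/
theorem hasCopula_indicator_chain {P : Measure Ω} [IsProbabilityMeasure P] {C : ℝ → ℝ → ℝ}
    (hC : IsCopula C) {A₁ A₂ B : Set Ω} (hA₁ : MeasurableSet A₁) (hA₂ : MeasurableSet A₂)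
    (hB : MeasurableSet B) (hA : A₂ ⊆ A₁)
    (h₁ : P.real (A₁ ∪ B) = copulaDual C (P.real A₁) (P.real B))
    (h₂ : P.real (A₂ ∪ B) = copulaDual C (P.real A₂) (P.real B)) :
    HasCopula P (fun ω => A₁.indicator (fun _ => (1 : ℝ)) ω + A₂.indicator (fun _ => (1 : ℝ)) ω)
      (B.indicator fun _ => (1 : ℝ)) C := by
  intro x y
  simp only [← measureReal_def]
  have hmem : ∀ S : Set Ω, P.real S ∈ Icc (0 : ℝ) 1 := fun S =>
    ⟨measureReal_nonneg, measureReal_le_one⟩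
  set X : Ω → ℝ := fun ω => A₁.indicator (fun _ => (1 : ℝ)) ω +
    A₂.indicator (fun _ => (1 : ℝ)) ω with hX
  set Y : Ω → ℝ := B.indicator fun _ => (1 : ℝ) with hY
  rw [ofPred_and]
  have hX_cases : {ω | X ω ≤ x} = ∅ ∨ {ω | X ω ≤ x} = A₁ᶜ ∨ {ω | X ω ≤ x} = A₂ᶜ ∨
      {ω | X ω ≤ x} = univ := by
    rcases lt_or_ge x 0 with c | c
    · left
      ext ω
      have := @hA ω
      by_cases a₁ : ω ∈ A₁ <;> by_cases a₂ : ω ∈ A₂ <;>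
        simp [hX, a₁, a₂] at this ⊢ <;> linarith
    rcases lt_or_ge x 1 with c' | c'
    · right; left
      ext ω
      have := @hA ω
      by_cases a₁ : ω ∈ A₁ <;> by_cases a₂ : ω ∈ A₂ <;>
        simp [hX, a₁, a₂] at this ⊢ <;> linarith
    rcases lt_or_ge x 2 with c'' | c''
    · right; right; left
      ext ω
      have := @hA ω
      by_cases a₁ : ω ∈ A₁ <;> by_cases a₂ : ω ∈ A₂ <;>
        simp [hX, a₁, a₂] at this ⊢ <;> linarith
    · right; right; right
      ext ω
      have := @hA ω
      by_cases a₁ : ω ∈ A₁ <;> by_cases a₂ : ω ∈ A₂ <;>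
        simp [hX, a₁, a₂] at this ⊢ <;> linarith
  have hY_cases : {ω | Y ω ≤ y} = ∅ ∨ {ω | Y ω ≤ y} = Bᶜ ∨ {ω | Y ω ≤ y} = univ := by
    rcases lt_or_ge y 0 with c | c
    · left
      ext ω
      by_cases b : ω ∈ B <;> simp [hY, b] <;> linarith
    rcases lt_or_ge y 1 with c' | c'
    · right; left
      ext ω
      by_cases b : ω ∈ B <;> simp [hY, b] <;> linarith
    · right; right
      ext ω
      by_cases b : ω ∈ B <;> simp [hY, b] <;> linarith
  have key : ∀ A, MeasurableSet A → P.real (A ∪ B) = copulaDual C (P.real A) (P.real B) →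
      P.real (Aᶜ ∩ Bᶜ) = C (P.real Aᶜ) (P.real Bᶜ) := by
    intro A hAm hAB
    rw [← compl_union, probReal_compl_eq_one_sub (hAm.union hB), hAB,
      probReal_compl_eq_one_sub hAm, probReal_compl_eq_one_sub hB, copulaDual]
    ring
  rcases hY_cases with e | e | e
  · rw [e, inter_empty, measureReal_empty, (hC.1 _ (hmem _)).1]
  · rcases hX_cases with e' | e' | e' | e'
    · rw [e', e, empty_inter, measureReal_empty, (hC.1 _ (hmem _)).2.1]
    · rw [e', e, key A₁ hA₁ h₁]
    · rw [e', e, key A₂ hA₂ h₂]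
    · rw [e', e, univ_inter, probReal_univ, (hC.1 _ (hmem _)).2.2.2]
  · rw [e, inter_univ, probReal_univ, (hC.1 _ (hmem _)).2.2.1]

/-- Universal maximality tested on `X = 1_{A₁} + 1_{A₂}` and `Y = 1_B`, where `A₂ ⊆ A₁` have
probabilities `a' ≤ a` and `B` has probability `b`; the competitor meets the layers `A₂`,
`A₁ \ A₂`, `A₁ᶜ` in the measures `c₁`, `c₂`, `c₃`. -/
theorem UnivMaximal.indicator_chain_le {P : Measure Ω} [IsProbabilityMeasure P]
    (hP : AtomlessProb P) {h : ℝ → ℝ} (h0 : h 0 = 0) (h1 : h 1 = 1) {C : ℝ → ℝ → ℝ}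
    (hC : IsCopula C) (hmax : UnivMaximal P h C) {a a' b c₁ c₂ c₃ : ℝ}
    (ha : a ∈ Icc (0 : ℝ) 1) (ha' : a' ∈ Icc (0 : ℝ) 1) (haa' : a' ≤ a)
    (hb : b ∈ Icc (0 : ℝ) 1) (h₁ : 0 ≤ c₁) (h₁' : c₁ ≤ a') (h₂ : 0 ≤ c₂) (h₂' : c₂ ≤ a - a')
    (h₃ : 0 ≤ c₃) (h₃' : c₃ ≤ 1 - a) (hsum : c₁ + c₂ + c₃ = b) :
    h (a + c₃) + h (a' + c₂) + h c₁ ≤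
      h (copulaDual C a b) + h (a + copulaDual C a' b - copulaDual C a b) +
        h (a' + b - copulaDual C a' b) := by
  obtain ⟨A₁, -, hA₁, rfl⟩ := hP.exists_subset_measureReal_eq MeasurableSet.univ ha.1
    (by simpa using ha.2)
  obtain ⟨A₂, hA, hA₂, rfl⟩ := hP.exists_subset_measureReal_eq hA₁ ha'.1 haa'
  have m₁ := hC.copulaDual_mono_left ha' ha hb haa'
  have m₂ := hC.copulaDual_sub_le ha' ha hb haa'
  have m₃ := hC.copulaDual_le_one ha hb
  have m₄ := hC.le_copulaDual_left ha hb
  have m₅ := hC.le_copulaDual_right ha' hb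
  have m₆ := hC.copulaDual_le_add ha' hb
  obtain ⟨B, hB, hB₀, hB₁, hB₂, hB₃, hB₄⟩ := hP.exists_set_meeting_chain hA₁ hA₂ hA
    (b₁ := P.real A₂ + b - copulaDual C (P.real A₂) b)
    (b₂ := P.real A₁ + copulaDual C (P.real A₂) b - copulaDual C (P.real A₁) b - P.real A₂)
    (b₃ := copulaDual C (P.real A₁) b - P.real A₁)
    (by linarith) (by linarith) (by linarith) (by linarith) (by linarith) (by linarith)
  obtain ⟨B', hB', hB₀', hB₁', hB₂', hB₃', hB₄'⟩ := hP.exists_set_meeting_chain hA₁ hA₂ hA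
    h₁ h₁' h₂ h₂' h₃ h₃'
  have hBb : P.real B = b := by rw [hB₀]; ring
  have bX := (isBddRV_indicator_one hA₁).add (isBddRV_indicator_one hA₂)
  have := hmax _ _ _ _ bX (isBddRV_indicator_one hB) bX (isBddRV_indicator_one hB')
    (hasCopula_indicator_chain hC hA₁ hA₂ hB hA (by rw [hB₁, hBb]; ring)
      (by rw [hB₂, hBb]; ring))
    (IdentDistrib.refl bX.1.aemeasurable)
    (identDistrib_indicator_one hB hB' (by rw [hBb, hB₀', hsum]))
  rw [distExp_indicator_chain_add h0 h1 hA, distExp_indicator_chain_add h0 h1 hA,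
    hB₁, hB₃, hB₄, hB₁', hB₃', hB₄'] at this
  convert this using 4 <;> ring

/-- Universal maximality tested on indicators of sets of probabilities `a` and `b`; the competitor
has an intersection of measure `c`. -/
theorem UnivMaximal.indicator_le {P : Measure Ω} [IsProbabilityMeasure P]
    (hP : AtomlessProb P) {h : ℝ → ℝ} (h0 : h 0 = 0) (h1 : h 1 = 1) {C : ℝ → ℝ → ℝ}
    (hC : IsCopula C) (hmax : UnivMaximal P h C) {a b c : ℝ}
    (ha : a ∈ Icc (0 : ℝ) 1) (hb : b ∈ Icc (0 : ℝ) 1) (hc : 0 ≤ c) (hca : c ≤ a) (hcb : c ≤ b)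
    (hc' : a + b - c ≤ 1) :
    h (a + b - c) + h c ≤ h (copulaDual C a b) + h (a + b - copulaDual C a b) := by
  have := UnivMaximal.indicator_chain_le hP h0 h1 hC hmax (c₁ := 0) (c₂ := c) (c₃ := b - c) ha
    ⟨le_rfl, zero_le_one⟩ ha.1 hb le_rfl le_rfl hc (by linarith) (by linarith) (by linarith)
    (by ring)
  rw [hC.copulaDual_zero_left hb] at this
  simpa [h0, add_sub_assoc] using this

/-! ### Identification of the copula -/

theorem StrictConvexOn.add_lt_add_of_inward {s : Set ℝ} {f : ℝ → ℝ} (hf : StrictConvexOn ℝ s f)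
    {x y ε : ℝ} (hx : x ∈ s) (hy : y ∈ s) (hε : 0 < ε) (hxy : x + ε < y) :
    f (x + ε) + f (y - ε) < f x + f y := by
  have hd : 0 < y - x := by linarith
  set t := ε / (y - x) with ht
  have ht0 : 0 < t := div_pos hε hd
  have ht1 : t < 1 := (div_lt_one hd).2 (by linarith)
  have hte : t * (y - x) = ε := div_mul_cancel₀ _ hd.ne'
  have e₁ := hf.2 hx hy (by linarith : x ≠ y) (sub_pos.2 ht1) ht0 (by ring)
  have e₂ := hf.2 hx hy (by linarith : x ≠ y) ht0 (sub_pos.2 ht1) (by ring)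
  simp only [smul_eq_mul] at e₁ e₂
  rw [show (1 - t) * x + t * y = x + ε by rw [← hte]; ring] at e₁
  rw [show t * x + (1 - t) * y = y - ε by rw [← hte]; ring] at e₂
  linarith

theorem StrictConcaveOn.add_lt_add_of_inward {s : Set ℝ} {f : ℝ → ℝ}
    (hf : StrictConcaveOn ℝ s f) {x y ε : ℝ} (hx : x ∈ s) (hy : y ∈ s) (hε : 0 < ε)
    (hxy : x + ε < y) : f x + f y < f (x + ε) + f (y - ε) := by
  have := hf.neg.add_lt_add_of_inward hx hy hε hxy
  simp only [Pi.neg_apply] at this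
  linarith

theorem copulaDual_eq_left_of_univMaximal {P : Measure Ω} [IsProbabilityMeasure P]
    (hP : AtomlessProb P) {h : ℝ → ℝ} (h0 : h 0 = 0) (h1 : h 1 = 1) {p : ℝ} (hp : 0 ≤ p)
    (hconc : StrictConcaveOn ℝ (Ioo p 1) h) {C : ℝ → ℝ → ℝ} (hC : IsCopula C)
    (hmax : UnivMaximal P h C) {a b : ℝ} (hpa : p < a) (ha1 : a ≤ 1) (hb0 : 0 ≤ b)
    (hba : b ≤ a) : copulaDual C a b = a := by
  have ha : a ∈ Icc (0 : ℝ) 1 := ⟨by linarith, ha1⟩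
  have hb : b ∈ Icc (0 : ℝ) 1 := ⟨hb0, by linarith⟩
  refine le_antisymm ?_ (hC.le_copulaDual_left ha hb)
  by_contra! hlt
  have hle := hC.copulaDual_le_one ha hb
  -- Shrink `b` so that the union has measure strictly between `a` and `1`.
  obtain ⟨b', hb', hd⟩ := intermediate_value_Icc hb0
    ((hC.continuousOn_copulaDual_right ha).mono (Icc_subset_Icc_right hb.2))
    (show (a + copulaDual C a b) / 2 ∈ Icc (copulaDual C a 0) (copulaDual C a b) by
      rw [hC.copulaDual_zero_right ha]; constructor <;> linarith)
  have hbI : b' ∈ Icc (0 : ℝ) 1 := ⟨hb'.1, hb'.2.trans hb.2⟩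
  have hb'b := hb'.2
  simp only at hd
  have hda : a < copulaDual C a b' := by linarith
  have hd1 : copulaDual C a b' < 1 := by linarith
  obtain ⟨x, hx, hxa⟩ := exists_between
    (max_lt hpa (by linarith : a + b' - copulaDual C a b' < a))
  have hpx := (le_max_left _ _).trans_lt hx
  have hsx := (le_max_right _ _).trans_lt hx
  -- The middle level set takes every measure from that of the intersection up to `a`.
  obtain ⟨a', ha', he⟩ := intermediate_value_Icc ha.1
    ((hC.continuousOn_copulaDual_left hbI).mono (Icc_subset_Icc_right ha.2))
    (show x + copulaDual C a b' - a ∈ Icc (copulaDual C 0 b') (copulaDual C a b') by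
      rw [hC.copulaDual_zero_left hbI]; constructor <;> linarith)
  have haI : a' ∈ Icc (0 : ℝ) 1 := ⟨ha'.1, ha'.2.trans ha1⟩
  simp only at he
  have m₂ := hC.copulaDual_sub_le haI ha hbI ha'.2
  have m₅ := hC.le_copulaDual_right haI hbI
  have m₆ := hC.copulaDual_le_add haI hbI
  obtain ⟨ε, hε, hε'⟩ := exists_between (lt_min (sub_pos.2 hda) (sub_pos.2 hxa))
  obtain ⟨hε₁, hε₂⟩ := lt_min_iff.1 hε'
  have key := UnivMaximal.indicator_chain_le hP h0 h1 hC hmax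
    (c₁ := a' + b' - copulaDual C a' b') (c₂ := x - a' + ε)
    (c₃ := copulaDual C a b' - a - ε) ha haI ha'.2 hbI (by linarith) (by linarith)
    (by linarith) (by linarith) (by linarith) (by linarith) (by linarith)
  have strict := hconc.add_lt_add_of_inward (x := x) (y := copulaDual C a b') (ε := ε)
    ⟨hpx, by linarith⟩ ⟨by linarith, hd1⟩ hε (by linarith)
  rw [show a + (copulaDual C a b' - a - ε) = copulaDual C a b' - ε by ring,
    show a' + (x - a' + ε) = x + ε by ring,
    show a + copulaDual C a' b' - copulaDual C a b' = x by linarith] at key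
  linarith

theorem min_le_copulaDual_of_univMaximal {P : Measure Ω} [IsProbabilityMeasure P]
    (hP : AtomlessProb P) {h : ℝ → ℝ} (h0 : h 0 = 0) (h1 : h 1 = 1) {p : ℝ} (hp : p ≤ 1)
    (hconv : StrictConvexOn ℝ (Ioo 0 p) h) {C : ℝ → ℝ → ℝ} (hC : IsCopula C)
    (hmax : UnivMaximal P h C) {a b : ℝ} (ha : a ∈ Icc (0 : ℝ) 1) (hb : b ∈ Icc (0 : ℝ) 1) :
    min (a + b) p ≤ copulaDual C a b := by
  by_contra! hlt
  obtain ⟨hs, hd⟩ := lt_min_iff.1 hlt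
  have ma := hC.le_copulaDual_left ha hb
  have mb := hC.le_copulaDual_right ha hb
  obtain ⟨ε, hε, hε'⟩ := exists_between (lt_min (sub_pos.2 hs) (sub_pos.2 hd))
  obtain ⟨hε₁, hε₂⟩ := lt_min_iff.1 hε'
  have key := UnivMaximal.indicator_le hP h0 h1 hC hmax (c := a + b - copulaDual C a b - ε)
    ha hb (by linarith) (by linarith) (by linarith) (by linarith)
  have ha0 := ha.1
  have hb0 := hb.1
  have strict := hconv.add_lt_add_of_inward (x := a + b - copulaDual C a b - ε)
    (y := copulaDual C a b + ε) (ε := ε) ⟨by linarith, by linarith⟩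
    ⟨by linarith, by linarith⟩ hε (by linarith)
  rw [show a + b - (a + b - copulaDual C a b - ε) = copulaDual C a b + ε by ring] at key
  rw [sub_add_cancel, add_sub_cancel_right] at strict
  linarith

theorem copulaDual_le_of_univMaximal {P : Measure Ω} [IsProbabilityMeasure P]
    (hP : AtomlessProb P) {h : ℝ → ℝ} (h0 : h 0 = 0) (h1 : h 1 = 1) {p : ℝ}
    (hp : p ∈ Ioo (0 : ℝ) 1) (hconc : StrictConcaveOn ℝ (Ioo p 1) h) {C : ℝ → ℝ → ℝ}
    (hC : IsCopula C) (hmax : UnivMaximal P h C) {a b : ℝ} (ha0 : 0 ≤ a) (hap : a ≤ p)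
    (hb0 : 0 ≤ b) (hbp : b ≤ p) : copulaDual C a b ≤ p := by
  obtain ⟨hp0, hp1⟩ := hp
  refine le_of_forall_gt_imp_ge_of_dense fun q hq => ?_
  rcases le_or_gt 1 q with h | h
  · exact (hC.copulaDual_le_one ⟨ha0, by linarith⟩ ⟨hb0, by linarith⟩).trans h
  · rw [← copulaDual_eq_left_of_univMaximal hP h0 h1 hp0.le hconc hC hmax hq h.le hb0
      (by linarith)]
    exact hC.copulaDual_mono_left ⟨ha0, by linarith⟩ ⟨by linarith, h.le⟩ ⟨hb0, by linarith⟩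
      (by linarith)

/-- Necessity in the S-shaped characterization: if h is strictly S-shaped
with inflection point p and the copula C is universally maximal for h with linear cost,
then C = C^±_p on the unit square and h'(p⁺) ≤ h'(0⁺). -/
theorem univMaximal_implies_Cpm_and_deriv_condition_of_strictSS
    (P : Measure Ω) [IsProbabilityMeasure P] (hP : AtomlessProb P)
    (h : ℝ → ℝ) (hdist : IsDistortion h)
    (p : ℝ) (hp : p ∈ Ioo (0:ℝ) 1) (hss : IsStrictSS h p)
    (C : ℝ → ℝ → ℝ) (hC : IsCopula C) (hmax : UnivMaximal P h C) :
    (∀ u ∈ Icc (0:ℝ) 1, ∀ v ∈ Icc (0:ℝ) 1, C u v = Cpm p u v) ∧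
    (∀ d0 dp : ℝ, HasDerivWithinAt h d0 (Ioi 0) 0 →
      HasDerivWithinAt h dp (Ioi p) p → dp ≤ d0) := by
  obtain ⟨-, h0, h1⟩ := hdist
  obtain ⟨-, hconv, hconc⟩ := hss
  obtain ⟨hp0, hp1⟩ := hp
  have upper : ∀ {a b : ℝ}, 0 ≤ a → a ≤ p → 0 ≤ b → b ≤ p → copulaDual C a b ≤ p :=
    copulaDual_le_of_univMaximal hP h0 h1 ⟨hp0, hp1⟩ hconc hC hmax
  have lower : ∀ {a b : ℝ}, a ∈ Icc (0 : ℝ) 1 → b ∈ Icc (0 : ℝ) 1 →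
      min (a + b) p ≤ copulaDual C a b :=
    min_le_copulaDual_of_univMaximal hP h0 h1 hp1.le hconv hC hmax
  constructor
  · intro u hu v hv
    obtain ⟨a, rfl⟩ : ∃ a, u = 1 - a := ⟨1 - u, by ring⟩
    obtain ⟨b, rfl⟩ : ∃ b, v = 1 - b := ⟨1 - v, by ring⟩
    have ha : a ∈ Icc (0 : ℝ) 1 := ⟨by linarith [hu.2], by linarith [hu.1]⟩
    have hb : b ∈ Icc (0 : ℝ) 1 := ⟨by linarith [hv.2], by linarith [hv.1]⟩
    have hCd : C (1 - a) (1 - b) = 1 - copulaDual C a b := by rw [copulaDual]; ring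
    rw [hCd]
    have ma := hC.le_copulaDual_left ha hb
    have mb := hC.le_copulaDual_right ha hb
    unfold Cpm
    split_ifs with hc
    · rw [min_sub_sub_left] at hc ⊢
      rcases (show p ≤ max a b by linarith).eq_or_lt with hmp | hpm
      · have := upper ha.1 ((le_max_left a b).trans hmp.ge) hb.1
          ((le_max_right a b).trans hmp.ge)
        have := max_le ma mb
        linarith
      · rcases le_total b a with hab | hab
        · rw [max_eq_left hab] at hpm ⊢
          rw [copulaDual_eq_left_of_univMaximal hP h0 h1 hp0.le hconc hC hmax hpm ha.2 hb.1 hab]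
        · rw [max_eq_right hab] at hpm ⊢
          have : copulaDual C a b = b := copulaDual_eq_left_of_univMaximal hP h0 h1 hp0.le hconc
            hC.swap hmax.swap hpm hb.2 ha.1 hab
          rw [this]
    · rw [min_sub_sub_left] at hc
      have hM : max a b < p := by linarith
      obtain ⟨hap, hbp⟩ := max_lt_iff.1 hM
      have : copulaDual C a b = min (a + b) p :=
        le_antisymm (le_min (hC.copulaDual_le_add ha hb) (upper ha.1 hap.le hb.1 hbp.le))
          (lower ha hb)
      rw [this, show 1 - a + (1 - b) - 1 = 1 - (a + b) by ring, max_sub_sub_left]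
  · intro d0 dp hd0 hdp
    have key : ∀ᶠ ε in nhdsWithin (0 : ℝ) (Ioi 0),
        ε⁻¹ * (h (p + ε) - h p) ≤ ε⁻¹ * (h (0 + ε) - h 0) := by
      have hmin : 0 < min p (1 - p) := lt_min hp0 (sub_pos.2 hp1)
      filter_upwards [Ioo_mem_nhdsGT hmin] with ε hε
      obtain ⟨hε0, hε'⟩ := hε
      obtain ⟨hεp, hεp'⟩ := lt_min_iff.1 hε'
      have hI : (p + ε) / 2 ∈ Icc (0 : ℝ) 1 := ⟨by linarith, by linarith⟩
      have hd : copulaDual C ((p + ε) / 2) ((p + ε) / 2) = p := by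
        refine le_antisymm (upper hI.1 (by linarith) hI.1 (by linarith)) ?_
        have := lower hI hI
        rwa [min_eq_right (by linarith)] at this
      have := UnivMaximal.indicator_le hP h0 h1 hC hmax (c := 0) hI hI le_rfl hI.1 hI.1
        (by linarith)
      rw [hd, sub_zero, add_halves, add_sub_cancel_left] at this
      refine mul_le_mul_of_nonneg_left ?_ (inv_nonneg.2 hε0.le)
      rw [zero_add]
      linarith
    have slope : ∀ {x d : ℝ}, HasDerivWithinAt h d (Ioi x) x →
        Filter.Tendsto (fun ε => ε⁻¹ * (h (x + ε) - h x)) (nhdsWithin (0 : ℝ) (Ioi 0))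
          (nhds d) := by
      intro x d hd
      have hshift : Filter.Tendsto (fun ε => x + ε) (nhdsWithin (0 : ℝ) (Ioi 0))
          (nhdsWithin x (Ioi x)) := by
        refine tendsto_nhdsWithin_iff.2 ⟨?_, ?_⟩
        · have : Filter.Tendsto (fun ε => x + ε) (nhds (0 : ℝ)) (nhds (x + 0)) :=
            (continuous_const_add x).tendsto 0
          rw [add_zero] at this
          exact this.mono_left nhdsWithin_le_nhds
        · filter_upwards [self_mem_nhdsWithin] with ε hε
          exact lt_add_of_pos_right x hε
      have := ((hasDerivWithinAt_iff_tendsto_slope' self_notMem_Ioi).1 hd).comp hshift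
      simpa [Function.comp_def, slope_def_module] using this
    exact le_of_tendsto_of_tendsto (slope hdp) (slope hd0) key
end
end

section
/- If c:ℝ²→ℝ is supermodular and monotone (increasing in each argument or decreasing in each argument), and f:ℝ→ℝ is increasing and convex, then the composition f∘c:ℝ²→ℝ is supermodular. -/
open MeasureTheory Set ProbabilityTheory

noncomputable section

variable {Ω : Type*} [MeasurableSpace Ω]

/-- A monotone convex function satisfies `f p + f q ≤ f a + f b` whenever `a` lies below both
`p` and `q` and `p + q ≤ a + b`. -/
theorem ConvexOn.add_le_add_of_monotone {f : ℝ → ℝ} (hfc : ConvexOn ℝ univ f) (hf : Monotone f)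
    {a b p q : ℝ} (hp : a ≤ p) (hq : a ≤ q) (h : p + q ≤ a + b) :
    f p + f q ≤ f a + f b := by
  rcases hp.eq_or_lt with rfl | hp'
  · gcongr
    exact hf (by linarith)
  have hpos : 0 < (p - a) + (q - a) := by linarith
  have hweights : (q - a) / ((p - a) + (q - a)) + (p - a) / ((p - a) + (q - a)) = 1 := by
    field_simp
    ring
  have hu : 0 ≤ (q - a) / ((p - a) + (q - a)) := div_nonneg (by linarith) hpos.le
  have hv : 0 ≤ (p - a) / ((p - a) + (q - a)) := div_nonneg (by linarith) hpos.le
  have hfp := hfc.2 (mem_univ a) (mem_univ (p + q - a)) hu hv hweights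
  have hfq := hfc.2 (mem_univ a) (mem_univ (p + q - a)) hv hu (by linarith)
  have hcp : (q - a) / ((p - a) + (q - a)) * a + (p - a) / ((p - a) + (q - a)) * (p + q - a)
      = p := by
    field_simp
    ring
  have hcq : (p - a) / ((p - a) + (q - a)) * a + (q - a) / ((p - a) + (q - a)) * (p + q - a)
      = q := by
    field_simp
    ring
  simp only [smul_eq_mul, hcp, hcq] at hfp hfq
  have hfs : f (p + q - a) ≤ f b := hf (by linarith)
  linear_combination hfp + hfq + hfs + (f a + f (p + q - a)) * hweights

/-- If c is supermodular and monotone and f is increasing and convex,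
then f ∘ c is supermodular. -/
theorem supermodular_comp_increasing_convex
    (c : ℝ → ℝ → ℝ) (hsup : Supermodular c) (hmono : MonotoneCost c)
    (f : ℝ → ℝ) (hf : Monotone f) (hfc : ConvexOn ℝ univ f) :
    Supermodular (fun x y => f (c x y)) := by
  intro x₁ y₁ x₂ y₂
  have h := hsup x₁ y₁ x₂ y₂
  rcases hmono with hc | hc
  · have h₁ := @hc (min x₁ x₂, min y₁ y₂) (x₁, y₁) ⟨min_le_left _ _, min_le_left _ _⟩
    have h₂ := @hc (min x₁ x₂, min y₁ y₂) (x₂, y₂) ⟨min_le_right _ _, min_le_right _ _⟩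
    exact hfc.add_le_add_of_monotone hf h₁ h₂ h
  · have h₁ := @hc (x₁, y₁) (max x₁ x₂, max y₁ y₂) ⟨le_max_left _ _, le_max_left _ _⟩
    have h₂ := @hc (x₂, y₂) (max x₁ x₂, max y₁ y₂) ⟨le_max_right _ _, le_max_right _ _⟩
    have hle := hfc.add_le_add_of_monotone hf h₁ h₂ (h.trans_eq (add_comm _ _))
    exact hle.trans_eq (add_comm _ _)
end
end
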